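/- Let G and H be da-hypomorphic digraphs. Suppose there exist distinct vertices u, v of G and distinct vertices u′, v′ of H with dt_G(u) = dt_H(u′) and dt_G(v) = dt_H(v′), together with an isomorphism from the digraph obtained from G by deleting all arcs between u and v to the digraph obtained from H by deleting all arcs between u′ and v′ sending u to u′ and v to v′. Then for every pair of distinct vertices x, y of G there exist distinct vertices x′, y′ of H with dt_G(x) = dt_H(x′) and dt_G(y) = dt_H(y′), together with an isomorphism from the digraph obtained from G by deleting all arcs between x and y to the digraph obtained from H by deleting all arcs between x′ and y′ sending x to x′ and y to y′. (That is: either every pair of dacards in the common dadeck is dapasted isomorphically in G and H, or no pair is.) -/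

import Mathlib

/-- An isomorphism between two digraphs (given as arc relations) is a vertex bijection
preserving the arc relation in both directions. -/
def DIso {V W : Type*} (D : V → V → Prop) (E : W → W → Prop) : Prop :=
  ∃ f : V ≃ W, ∀ x y, D x y ↔ E (f x) (f y)

/-- The card of a digraph `D` obtained by deleting the vertex `v`. -/
def dCard {V : Type*} (D : V → V → Prop) (v : V) :
    {x : V // x ≠ v} → {x : V // x ≠ v} → Prop :=
  fun x y => D x.1 y.1

/-- Two digraphs on `Fin n` are hypomorphic if some bijection of their vertex sets
matches each card of one with an isomorphic card of the other. -/
def DHypomorphic {n : ℕ} (D E : Fin n → Fin n → Prop) : Prop :=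
  ∃ σ : Fin n ≃ Fin n, ∀ v, DIso (dCard D v) (dCard E (σ v))

/-- First degree: the number of out-neighbors of `v`. -/
noncomputable def aDeg {V : Type*} (D : V → V → Prop) (v : V) : ℕ :=
  Nat.card {w : V // D v w ∧ ¬ D w v}

/-- Second degree: the number of in-neighbors of `v`. -/
noncomputable def bDeg {V : Type*} (D : V → V → Prop) (v : V) : ℕ :=
  Nat.card {w : V // D w v ∧ ¬ D v w}

/-- Third degree: the number of strong neighbors of `v`. -/
noncomputable def cDeg {V : Type*} (D : V → V → Prop) (v : V) : ℕ :=
  Nat.card {w : V // D v w ∧ D w v}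

/-- The degree triple of a vertex. -/
noncomputable def degTriple {V : Type*} (D : V → V → Prop) (v : V) : ℕ × ℕ × ℕ :=
  (aDeg D v, bDeg D v, cDeg D v)

/-- Two digraphs on `Fin n` are da-hypomorphic if some bijection of their vertex sets
matches each card of one with an isomorphic card of the other, the deleted vertices
having the same degree triple. -/
def DaHypomorphic {n : ℕ} (D E : Fin n → Fin n → Prop) : Prop :=
  ∃ σ : Fin n ≃ Fin n, ∀ v, DIso (dCard D v) (dCard E (σ v)) ∧
    degTriple D v = degTriple E (σ v)

/-- The digraph obtained from `D` by deleting all arcs between `u` and `v`. -/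
def delPair {V : Type*} (D : V → V → Prop) (u v : V) : V → V → Prop :=
  fun x y => D x y ∧ ¬((x = u ∧ y = v) ∨ (x = v ∧ y = u))

/-- If two predicates with equally many solutions agree along a bijection away from one
point, then they agree at that point as well. -/
theorem iff_of_card_eq_of_iff_ne {α β : Type*} [Finite α] (φ : α ≃ β)
    {P : α → Prop} {Q : β → Prop} (v : α) (h : ∀ w, w ≠ v → (P w ↔ Q (φ w)))
    (hcard : Nat.card {w // P w} = Nat.card {w // Q w}) : P v ↔ Q (φ v) := by
  have hQ : Nat.card {w // Q (φ w)} = Nat.card {w // Q w} :=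
    Nat.card_congr (φ.subtypeEquiv fun _ => Iff.rfl)
  have hcard' : Set.ncard {w | P w} = Set.ncard {w | Q (φ w)} := hcard.trans hQ.symm
  constructor
  · intro hv
    have hsub : {w | Q (φ w)} ⊆ {w | P w} := fun w hw => by
      by_cases hwv : w = v
      · exact hwv ▸ hv
      · exact (h w hwv).2 hw
    have heq := Set.eq_of_subset_of_ncard_le hsub hcard'.le
    exact heq.symm.subset hv
  · intro hv
    have hsub : {w | P w} ⊆ {w | Q (φ w)} := fun w hw => by
      by_cases hwv : w = v
      · exact hwv ▸ hv
      · exact (h w hwv).1 hw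
    have heq := Set.eq_of_subset_of_ncard_le hsub hcard'.ge
    exact heq.symm.subset hv

/-- An isomorphism of digraphs with the arcs between a pair of vertices deleted is an
isomorphism of the digraphs themselves as soon as it preserves the degree triple of one
vertex of the pair. -/
theorem iff_of_delPair_iff_of_degTriple_eq {V W : Type*} [Finite V]
    {D : V → V → Prop} {E : W → W → Prop} {u v : V} (huv : u ≠ v) (φ : V ≃ W)
    (hφ : ∀ x y, delPair D u v x y ↔ delPair E (φ u) (φ v) (φ x) (φ y))
    (hdeg : degTriple D u = degTriple E (φ u)) (x y : V) : D x y ↔ E (φ x) (φ y) := by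
  simp only [delPair, φ.injective.eq_iff] at hφ
  simp only [degTriple, Prod.mk.injEq] at hdeg
  obtain ⟨hout, hin, hstrong⟩ := hdeg
  have hto : ∀ w, w ≠ v → (D u w ↔ E (φ u) (φ w)) := fun w hw => by
    simpa [hw, huv] using hφ u w
  have hfrom : ∀ w, w ≠ v → (D w u ↔ E (φ w) (φ u)) := fun w hw => by
    simpa [hw, huv] using hφ w u
  have ha := iff_of_card_eq_of_iff_ne φ (P := fun w => D u w ∧ ¬ D w u)
    (Q := fun w => E (φ u) w ∧ ¬ E w (φ u)) v
    (fun w hw => by rw [hto w hw, hfrom w hw]) hout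
  have hb := iff_of_card_eq_of_iff_ne φ (P := fun w => D w u ∧ ¬ D u w)
    (Q := fun w => E w (φ u) ∧ ¬ E (φ u) w) v
    (fun w hw => by rw [hto w hw, hfrom w hw]) hin
  have hc := iff_of_card_eq_of_iff_ne φ (P := fun w => D u w ∧ D w u)
    (Q := fun w => E (φ u) w ∧ E w (φ u)) v
    (fun w hw => by rw [hto w hw, hfrom w hw]) hstrong
  by_cases hxy : (x = u ∧ y = v) ∨ (x = v ∧ y = u)
  · rcases hxy with ⟨rfl, rfl⟩ | ⟨rfl, rfl⟩ <;> tauto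
  · simpa [hxy] using hφ x y

/-- Isomorphisms of digraphs preserve degree triples. -/
theorem degTriple_eq_of_iff {V W : Type*} {D : V → V → Prop} {E : W → W → Prop}
    (φ : V ≃ W) (hφ : ∀ x y, D x y ↔ E (φ x) (φ y)) (v : V) :
    degTriple D v = degTriple E (φ v) := by
  simp only [degTriple, aDeg, bDeg, cDeg, Prod.mk.injEq]
  refine ⟨Nat.card_congr (φ.subtypeEquiv fun w => ?_),
    Nat.card_congr (φ.subtypeEquiv fun w => ?_),
    Nat.card_congr (φ.subtypeEquiv fun w => ?_)⟩ <;> rw [hφ, hφ]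

/-- Corollary 5.9 / Theorem 5.11, digraph case: if `G` and `H` are da-hypomorphic
digraphs and one pair of dacards is dapasted isomorphically in `G` and `H` (there are
distinct `u, v` and distinct `u', v'` with matching degree triples and an isomorphism
from `G` minus the arcs between `u, v` to `H` minus the arcs between `u', v'` sending
`u ↦ u'`, `v ↦ v'`), then every pair of dacards is dapasted isomorphically in `G`
and `H`. -/
theorem stmt19 {n : ℕ} (G H : Fin n → Fin n → Prop)
    (hG : Irreflexive G) (hH : Irreflexive H) (hda : DaHypomorphic G H)
    (hone : ∃ u v : Fin n, u ≠ v ∧ ∃ u' v' : Fin n, u' ≠ v' ∧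
      degTriple G u = degTriple H u' ∧ degTriple G v = degTriple H v' ∧
      ∃ φ : Fin n ≃ Fin n,
        (∀ x y, delPair G u v x y ↔ delPair H u' v' (φ x) (φ y)) ∧
        φ u = u' ∧ φ v = v') :
    ∀ x y : Fin n, x ≠ y → ∃ x' y' : Fin n, x' ≠ y' ∧
      degTriple G x = degTriple H x' ∧ degTriple G y = degTriple H y' ∧
      ∃ φ : Fin n ≃ Fin n,
        (∀ a b, delPair G x y a b ↔ delPair H x' y' (φ a) (φ b)) ∧
        φ x = x' ∧ φ y = y' := by
  obtain ⟨u, v, huv, _, _, -, hu, -, φ, hφ, rfl, rfl⟩ := hone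
  have hiso := iff_of_delPair_iff_of_degTriple_eq huv φ hφ hu
  intro x y hxy
  refine ⟨φ x, φ y, φ.injective.ne hxy, degTriple_eq_of_iff φ hiso x,
    degTriple_eq_of_iff φ hiso y, φ, fun a b => ?_, rfl, rfl⟩
  simp only [delPair, φ.injective.eq_iff, hiso a b]
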